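/- Let H be a positive integer and let J : ℝ^H → ℝ^H be an invertible linear map. Then log |det J| ≤ H · ∫_{S^{H−1}} log ‖J u‖ dσ(u), where σ is the uniform (normalized rotation-invariant) probability measure on the unit sphere S^{H−1} ⊂ ℝ^H and ‖·‖ is the Euclidean norm. Equality holds if J = C · I for some nonzero real constant C. -/

import Mathlib

open MeasureTheory

/-- The uniform (normalized rotation-invariant) probability measure on the unit sphere
`S^{H-1} ⊂ ℝ^H`, obtained by normalizing the surface measure induced by Lebesgue measure. -/
noncomputable def uniformSphereMeasure (H : ℕ) :
    Measure (Metric.sphere (0 : EuclideanSpace ℝ (Fin H)) 1) :=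
  ((volume : Measure (EuclideanSpace ℝ (Fin H))).toSphere Set.univ)⁻¹ •
    (volume : Measure (EuclideanSpace ℝ (Fin H))).toSphere

open Metric Set Measure in
/-- Integration in polar coordinates of the indicator of the preimage of the unit ball
under an invertible linear map. -/
theorem lintegral_toSphere_inv_norm_pow {E : Type*} [NormedAddCommGroup E] [NormedSpace ℝ E]
    [MeasurableSpace E] [BorelSpace E] [FiniteDimensional ℝ E] [Nontrivial E]
    (μ : Measure E) [μ.IsAddHaarMeasure] {J : E →ₗ[ℝ] E} (hJ : LinearMap.det J ≠ 0) :
    ∫⁻ u : sphere (0 : E) 1, ENNReal.ofReal (‖J u‖⁻¹ ^ Module.finrank ℝ E) ∂μ.toSphere =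
      ENNReal.ofReal |(LinearMap.det J)⁻¹| * μ.toSphere univ := by
  have hinj : Function.Injective J := (LinearMap.equivOfDetNeZero J hJ).injective
  have hcont : Continuous J := J.continuous_of_finiteDimensional
  have hJpos (u : sphere (0 : E) 1) : 0 < ‖J u‖ :=
    norm_pos_iff.2 fun h ↦ ne_zero_of_mem_unit_sphere u (hinj (h.trans (map_zero J).symm))
  have hcinv : Continuous fun u : sphere (0 : E) 1 ↦ ‖J u‖⁻¹ :=
    (hcont.comp continuous_subtype_val).norm.inv₀ fun u ↦ (hJpos u).ne'
  set n := Module.finrank ℝ E with hn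
  have hnpos : 0 < n := Module.finrank_pos
  let S : Set (sphere (0 : E) 1 × Ioi (0 : ℝ)) := {p | (p.2 : ℝ) < ‖J p.1‖⁻¹}
  have hS : MeasurableSet S :=
    (isOpen_lt (continuous_subtype_val.comp continuous_snd)
      (hcinv.comp continuous_fst)).measurableSet
  have hpre : ((↑) : ({0}ᶜ : Set E) → E) '' (homeomorphUnitSphereProd E ⁻¹' S) =
      J ⁻¹' ball 0 1 \ {0} := by
    ext x
    have key (hx : x ≠ 0) : ‖x‖ < ‖J (‖x‖⁻¹ • x)‖⁻¹ ↔ ‖J x‖ < 1 := by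
      have hx' : 0 < ‖x‖ := norm_pos_iff.2 hx
      have hJx : 0 < ‖J x‖ := norm_pos_iff.2 fun h ↦ hx (hinj (h.trans (map_zero J).symm))
      rw [map_smul, norm_smul, norm_inv, norm_norm, mul_inv, inv_inv,
        lt_mul_iff_one_lt_right hx', one_lt_inv₀ hJx]
    constructor
    · rintro ⟨⟨y, hy⟩, h, rfl⟩
      have h' : ‖y‖ < ‖J (‖y‖⁻¹ • y)‖⁻¹ := by simpa [S] using h
      exact ⟨by simpa using (key hy).1 h', hy⟩
    · rintro ⟨h, hx⟩
      refine ⟨⟨x, hx⟩, ?_, rfl⟩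
      have := (key hx).2 (by simpa using h)
      simpa [S] using this
  have hvol : μ.toSphere.prod (volumeIoiPow (n - 1)) S =
      ENNReal.ofReal |(LinearMap.det J)⁻¹| * μ (ball 0 1) := by
    rw [← μ.measurePreserving_homeomorphUnitSphereProd.measure_preimage hS.nullMeasurableSet,
      comap_subtype_coe_apply (measurableSet_singleton _).compl, hpre,
      measure_sdiff_null (measure_singleton _), addHaar_preimage_linearMap μ hJ]
  have hslice (u : sphere (0 : E) 1) : volumeIoiPow (n - 1) (Prod.mk u ⁻¹' S) =
      ENNReal.ofReal (‖J u‖⁻¹ ^ n) / n := by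
    have : Prod.mk u ⁻¹' S = Iio ⟨‖J u‖⁻¹, inv_pos.2 (hJpos u)⟩ := rfl
    rw [this, volumeIoiPow_apply_Iio, Nat.sub_add_cancel hnpos, Nat.cast_pred hnpos,
      sub_add_cancel, ENNReal.ofReal_div_of_pos (by positivity), ENNReal.ofReal_natCast]
  rw [prod_apply hS] at hvol
  simp_rw [hslice, div_eq_mul_inv] at hvol
  rw [lintegral_mul_const _ (by exact (hcinv.pow n).measurable.ennreal_ofReal)] at hvol
  have hn0' : (n : ENNReal) ≠ 0 := Nat.cast_ne_zero.2 hnpos.ne'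
  rw [toSphere_apply_univ, ← hn, mul_left_comm, ← hvol, mul_comm (n : ENNReal), mul_assoc,
    ENNReal.inv_mul_cancel hn0' (ENNReal.natCast_ne_top n), mul_one]

theorem isProbabilityMeasure_uniformSphereMeasure {H : ℕ} (hH : 0 < H) :
    IsProbabilityMeasure (uniformSphereMeasure H) := by
  have : Nonempty (Fin H) := ⟨⟨0, hH⟩⟩
  refine ⟨?_⟩
  rw [uniformSphereMeasure, Measure.smul_apply, smul_eq_mul]
  exact ENNReal.inv_mul_cancel (Measure.measure_univ_ne_zero.2 (Measure.toSphere_ne_zero _)) (measure_ne_top _ _)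

theorem integral_uniformSphereMeasure_inv_norm_pow {H : ℕ} (hH : 0 < H)
    {J : EuclideanSpace ℝ (Fin H) →ₗ[ℝ] EuclideanSpace ℝ (Fin H)} (hJ : LinearMap.det J ≠ 0) :
    ∫ u : Metric.sphere (0 : EuclideanSpace ℝ (Fin H)) 1, ‖J u‖⁻¹ ^ H
      ∂(uniformSphereMeasure H) = |LinearMap.det J|⁻¹ := by
  have : Nonempty (Fin H) := ⟨⟨0, hH⟩⟩
  have hmeas : Measurable fun u : Metric.sphere (0 : EuclideanSpace ℝ (Fin H)) 1 ↦
      ‖J u‖⁻¹ ^ H :=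
    (J.continuous_of_finiteDimensional.comp
      continuous_subtype_val).norm.measurable.inv.pow_const H
  have h := lintegral_toSphere_inv_norm_pow (volume : Measure (EuclideanSpace ℝ (Fin H))) hJ
  rw [finrank_euclideanSpace_fin] at h
  rw [integral_eq_lintegral_of_nonneg_ae (.of_forall fun u ↦ by positivity)
    hmeas.aestronglyMeasurable, uniformSphereMeasure, lintegral_smul_measure, h, smul_eq_mul,
    mul_left_comm, ENNReal.inv_mul_cancel (Measure.measure_univ_ne_zero.2 (Measure.toSphere_ne_zero _))
      (measure_ne_top _ _), mul_one, ENNReal.toReal_ofReal (abs_nonneg _), abs_inv]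

/-- For an invertible linear map `J : ℝ^H → ℝ^H`,
`log |det J| ≤ H · ∫_{S^{H-1}} log ‖J u‖ dσ(u)`, where `σ` is the uniform probability measure
on the unit sphere; with equality if `J = C • id` for some nonzero constant `C`. -/
theorem log_det_le_dim_mul_integral_sphere
    (H : ℕ) (hH : 0 < H)
    (J : EuclideanSpace ℝ (Fin H) →ₗ[ℝ] EuclideanSpace ℝ (Fin H))
    (hJ : Function.Bijective J) :
    Real.log |LinearMap.det J| ≤
      H * ∫ u : Metric.sphere (0 : EuclideanSpace ℝ (Fin H)) 1,
        Real.log ‖J u‖ ∂(uniformSphereMeasure H) ∧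
    (∀ C : ℝ, C ≠ 0 → J = C • LinearMap.id →
      Real.log |LinearMap.det J| =
        H * ∫ u : Metric.sphere (0 : EuclideanSpace ℝ (Fin H)) 1,
          Real.log ‖J u‖ ∂(uniformSphereMeasure H)) := by
  have hdet : LinearMap.det J ≠ 0 :=
    ((LinearMap.isUnit_iff_isUnit_det J).1 ((Module.End.isUnit_iff J).2 hJ)).ne_zero
  have := isProbabilityMeasure_uniformSphereMeasure hH
  have hJpos (u : Metric.sphere (0 : EuclideanSpace ℝ (Fin H)) 1) : 0 < ‖J u‖ :=
    norm_pos_iff.2 fun h ↦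
      ne_zero_of_mem_unit_sphere u (hJ.injective (h.trans (map_zero J).symm))
  have hcont : Continuous fun u : Metric.sphere (0 : EuclideanSpace ℝ (Fin H)) 1 ↦ ‖J u‖ :=
    (J.continuous_of_finiteDimensional.comp continuous_subtype_val).norm
  have hd : 0 < |LinearMap.det J| := abs_pos.2 hdet
  constructor
  · have hlog : Integrable (fun u : Metric.sphere (0 : EuclideanSpace ℝ (Fin H)) 1 ↦
        Real.log ‖J u‖) (uniformSphereMeasure H) :=
      (hcont.log fun u ↦ (hJpos u).ne').integrable_of_hasCompactSupport
        (HasCompactSupport.of_compactSpace _)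
    have hpow : Integrable (fun u : Metric.sphere (0 : EuclideanSpace ℝ (Fin H)) 1 ↦
        ‖J u‖⁻¹ ^ H) (uniformSphereMeasure H) :=
      ((hcont.inv₀ fun u ↦ (hJpos u).ne').pow H).integrable_of_hasCompactSupport
        (HasCompactSupport.of_compactSpace _)
    have hle (u : Metric.sphere (0 : EuclideanSpace ℝ (Fin H)) 1) :
        Real.log |LinearMap.det J| - H * Real.log ‖J u‖ ≤
          |LinearMap.det J| * ‖J u‖⁻¹ ^ H - 1 := by
      have hp : 0 < ‖J u‖⁻¹ ^ H := pow_pos (inv_pos.2 (hJpos u)) H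
      have := Real.log_le_sub_one_of_pos (mul_pos hd hp)
      rw [Real.log_mul hd.ne' hp.ne', Real.log_pow, Real.log_inv] at this
      linarith
    have hint := integral_mono ((integrable_const _).sub (hlog.const_mul _))
      ((hpow.const_mul _).sub (integrable_const _)) hle
    rw [integral_sub' (integrable_const _) (hlog.const_mul _),
      integral_sub' (hpow.const_mul _) (integrable_const _), integral_const_mul,
      integral_const_mul, integral_uniformSphereMeasure_inv_norm_pow hH hdet,
      mul_inv_cancel₀ hd.ne'] at hint
    simp only [integral_const, probReal_univ, one_smul, sub_self] at hint
    linarith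
  · rintro C - rfl
    simp [norm_smul, abs_pow]
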